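/- Let n ≥ 4 be divisible by 4. There is no permutation σ of {1,…,n} whose cycle type is (n/2, n/2) (i.e., σ is a product of two disjoint cycles each of length n/2) such that the longest increasing subsequence of σ has length 3 and the longest decreasing subsequence of σ has length n−2. -/

import Mathlib

open Equiv

/-- `s` is (the index set of) an increasing subsequence of the permutation `σ`. -/
def IsIncSubseq {n : ℕ} (σ : Perm (Fin n)) (s : Finset (Fin n)) : Prop :=
  ∀ i ∈ s, ∀ j ∈ s, i < j → σ i < σ j

/-- `s` is (the index set of) a decreasing subsequence of the permutation `σ`. -/
def IsDecSubseq {n : ℕ} (σ : Perm (Fin n)) (s : Finset (Fin n)) : Prop :=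
  ∀ i ∈ s, ∀ j ∈ s, i < j → σ j < σ i

/-- The cycle type of `σ`, counting each fixed point as a cycle of length `1`. -/
def fullCycleType {n : ℕ} (σ : Perm (Fin n)) : Multiset ℕ :=
  σ.cycleType + Multiset.replicate (n - σ.cycleType.sum) 1

/-- If all cycles of `σ` have length `h`, then `h` is the period of every point. -/
lemma pow_apply_eq_self_iff_of_cycleType {n h : ℕ} {σ : Perm (Fin n)}
    (hfix : ∀ x, σ x ≠ x) (hc : ∀ k ∈ σ.cycleType, k = h) (x : Fin n) (t : ℕ) :
    (σ ^ t) x = x ↔ h ∣ t := by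
  have hcyc : (σ.cycleOf x).IsCycle := Perm.isCycle_cycleOf σ (hfix x)
  have hmem : σ.cycleOf x ∈ σ.cycleFactorsFinset :=
    Perm.cycleOf_mem_cycleFactorsFinset_iff.2 (Perm.mem_support.2 (hfix x))
  have hcard : (σ.cycleOf x).support.card = h := by
    apply hc
    rw [Perm.cycleType_def]
    exact Multiset.mem_map_of_mem _ hmem
  rw [← hcard, ← hcyc.orderOf, orderOf_dvd_iff_pow_eq_one,
    hcyc.pow_eq_one_iff' (x := x) (by rw [Perm.cycleOf_apply_self]; exact hfix x),
    Perm.cycleOf_pow_apply_self]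

lemma cycleType_eq_of_fullCycleType_eq {n h : ℕ} (hh : 2 ≤ h) {σ : Perm (Fin n)}
    (hσ : fullCycleType σ = {h, h}) : σ.cycleType = {h, h} := by
  have h1 : (1 : ℕ) ∉ fullCycleType σ := by
    rw [hσ]; simp; omega
  have h0 : n - σ.cycleType.sum = 0 := by
    by_contra hne
    exact h1 (Multiset.mem_add.2 (Or.inr (Multiset.mem_replicate.2 ⟨hne, rfl⟩)))
  simpa [fullCycleType, h0] using hσ

/-- An orbit inside a decreasing subsequence has length at most `2`. -/
lemma sq_apply_eq_self_of_orbit_dec {n h : ℕ} (hh : 0 < h) {σ : Perm (Fin n)}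
    {D : Finset (Fin n)} (hD : IsDecSubseq σ D) {x : Fin n}
    (hx : ∀ t : ℕ, (σ ^ t) x ∈ D) (hper : (σ ^ h) x = x) : (σ ^ 2) x = x := by
  have hper2 : (σ ^ (2 * h)) x = x := by
    rw [two_mul, pow_add, Perm.mul_apply, hper, hper]
  have step : ∀ s t : ℕ, (σ ^ s) x < (σ ^ t) x → (σ ^ (s + 2)) x < (σ ^ (t + 2)) x := by
    intro s t hst
    have h1 := hD _ (hx s) _ (hx t) hst
    rw [← Perm.mul_apply, ← Perm.mul_apply, ← pow_succ', ← pow_succ'] at h1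
    have h2 := hD _ (hx (t + 1)) _ (hx (s + 1)) h1
    rwa [← Perm.mul_apply, ← Perm.mul_apply, ← pow_succ', ← pow_succ'] at h2
  rcases lt_trichotomy ((σ ^ 2) x) x with hlt | heq | hgt
  · have hmono : StrictAnti fun k : ℕ => (σ ^ (2 * k)) x := by
      refine strictAnti_nat_of_succ_lt fun k => ?_
      induction k with
      | zero => simpa using hlt
      | succ k ih => exact step _ _ ih
    have := hmono hh
    simp [hper2] at this
  · exact heq
  · have hmono : StrictMono fun k : ℕ => (σ ^ (2 * k)) x := by
      refine strictMono_nat_of_lt_succ fun k => ?_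
      induction k with
      | zero => simpa using hgt
      | succ k ih => exact step _ _ ih
    have := hmono hh
    simp [hper2] at this

/-- The orbits of `a < b` with `σ a < σ b` compare alternately, as long as they stay inside a
decreasing subsequence; so they cannot both return at the same even time. -/
lemma pow_apply_alternating {n h : ℕ} {σ : Perm (Fin n)} {D : Finset (Fin n)}
    (hD : IsDecSubseq σ D) {a b : Fin n} (hab : σ a < σ b)
    (ha : ∀ t, 0 < t → t < h → (σ ^ t) a ∈ D) (hb : ∀ t, 0 < t → t < h → (σ ^ t) b ∈ D)
    (t : ℕ) (ht : t < h) :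
    if Even t then (σ ^ (t + 1)) a < (σ ^ (t + 1)) b
    else (σ ^ (t + 1)) b < (σ ^ (t + 1)) a := by
  induction t with
  | zero => simpa using hab
  | succ t ih =>
    have ih := ih (by omega)
    have ha := ha (t + 1) (by omega) ht
    have hb := hb (t + 1) (by omega) ht
    rw [pow_succ' σ (t + 1), Perm.mul_apply, Perm.mul_apply]
    by_cases he : Even t
    · rw [if_pos he] at ih
      rw [if_neg (by simpa [Nat.even_add_one] using he)]
      exact hD _ ha _ hb ih
    · rw [if_neg he] at ih
      rw [if_pos (by simpa [Nat.even_add_one] using he)]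
      exact hD _ hb _ ha ih

/-- A decreasing subsequence of length `n - 2` together with an increasing one of length `3`
leaves out two points that are in increasing order. -/
lemma exists_increasing_pair {n : ℕ} (hn : 2 ≤ n) {σ : Perm (Fin n)} {s D : Finset (Fin n)}
    (hs : IsIncSubseq σ s) (hs3 : s.card = 3) (hD : IsDecSubseq σ D) (hDc : D.card = n - 2) :
    ∃ a b, a < b ∧ σ a < σ b ∧ ∀ x, x ≠ a → x ≠ b → x ∈ D := by
  have hcompl : Dᶜ.card = 2 := by
    rw [Finset.card_compl, hDc, Fintype.card_fin]; omega
  have hint : (s ∩ D).card ≤ 1 := by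
    refine Finset.card_le_one.2 fun x hx y hy => ?_
    rw [Finset.mem_inter] at hx hy
    by_contra hne
    rcases lt_or_gt_of_ne hne with h | h
    · exact lt_asymm (hs _ hx.1 _ hy.1 h) (hD _ hx.2 _ hy.2 h)
    · exact lt_asymm (hs _ hy.1 _ hx.1 h) (hD _ hy.2 _ hx.2 h)
  have hsub : Dᶜ ⊆ s := by
    have h1 := Finset.card_inter_add_card_sdiff s D
    have h2 : s \ D ⊆ Dᶜ := fun x hx => by simpa using (Finset.mem_sdiff.1 hx).2
    have h3 : s \ D = Dᶜ := Finset.eq_of_subset_of_card_le h2 (by omega)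
    exact h3 ▸ Finset.sdiff_subset
  obtain ⟨a, b, hne, hDab⟩ := Finset.card_eq_two.1 hcompl
  have hmem : ∀ x, x ≠ a → x ≠ b → x ∈ D := fun x hxa hxb => by
    by_contra hx
    have : x ∈ Dᶜ := Finset.mem_compl.2 hx
    rw [hDab] at this
    simp [hxa, hxb] at this
  have has : a ∈ s := hsub (by simp [hDab])
  have hbs : b ∈ s := hsub (by simp [hDab])
  rcases lt_or_gt_of_ne hne with h | h
  · exact ⟨a, b, h, hs _ has _ hbs h, hmem⟩
  · exact ⟨b, a, h, hs _ hbs _ has h, fun x hxb hxa => hmem x hxa hxb⟩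

/-- For `n ≥ 4` divisible by `4`, no permutation of `{1,…,n}` with cycle type
`(n/2, n/2)` has longest increasing subsequence of length `3` and longest
decreasing subsequence of length `n - 2`. -/
theorem no_perm_cycleType_half_half_shape_three_hook
    (n : ℕ) (hn : 4 ≤ n) (hdvd : 4 ∣ n) :
    ¬ ∃ σ : Perm (Fin n),
      fullCycleType σ = {n / 2, n / 2} ∧
      ((∃ s, IsIncSubseq σ s ∧ s.card = 3) ∧
        (∀ s, IsIncSubseq σ s → s.card ≤ 3)) ∧
      ((∃ s, IsDecSubseq σ s ∧ s.card = n - 2) ∧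
        (∀ s, IsDecSubseq σ s → s.card ≤ n - 2)) := by
  rintro ⟨σ, hσ, ⟨⟨s, hs, hs3⟩, -⟩, ⟨D, hD, hDc⟩, -⟩
  obtain ⟨a, b, hab, hσab, hmem⟩ := exists_increasing_pair (by omega) hs hs3 hD hDc
  obtain ⟨m, rfl⟩ := hdvd
  obtain ⟨h, hh⟩ : ∃ h, h = 4 * m / 2 := ⟨_, rfl⟩
  rw [← hh] at hσ
  have hct := cycleType_eq_of_fullCycleType_eq (by omega) hσ
  have hfix : ∀ x, σ x ≠ x := by
    have hsum := σ.sum_cycleType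
    have huniv : σ.support = Finset.univ := by
      rw [← Finset.card_eq_iff_eq_univ, ← hsum, hct, Fintype.card_fin]
      simp; omega
    intro x
    rw [← Perm.mem_support, huniv]
    exact Finset.mem_univ x
  have hperiod := pow_apply_eq_self_iff_of_cycleType (h := h) hfix (by simp [hct])
  by_cases hsc : σ.SameCycle a b
  · obtain ⟨x, hx⟩ : ∃ x, ¬ σ.SameCycle a x := by
      by_contra! hall
      have hcyc : σ.IsCycle := ⟨a, hfix a, fun y _ => hall y⟩
      have := hcyc.cycleType
      rw [hct] at this
      simpa using congrArg Multiset.card this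
    have hxD : ∀ t : ℕ, (σ ^ t) x ∈ D := by
      intro t
      apply hmem
      · intro he
        exact hx (Perm.SameCycle.symm ⟨t, by simpa using he⟩)
      · intro he
        exact hx (hsc.trans (Perm.SameCycle.symm ⟨t, by simpa using he⟩))
    have h2 := sq_apply_eq_self_of_orbit_dec (h := h) (by omega) hD hxD ((hperiod x h).2 dvd_rfl)
    have hle := Nat.le_of_dvd (by norm_num) ((hperiod x 2).1 h2)
    have hsq : (σ ^ 2) a = a := (hperiod a 2).2 (by rw [show h = 2 by omega])
    obtain ⟨i, -, -, hi⟩ := hsc.exists_pow_eq σ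
    have hba : b = σ a := by
      rcases Nat.even_or_odd' i with ⟨k, rfl | rfl⟩
      · exact absurd (((hperiod a (2 * k)).2 (by
          rw [show h = 2 by omega]; exact dvd_mul_right 2 k)).symm.trans hi) hab.ne
      · rw [pow_succ', Perm.mul_apply, (hperiod a (2 * k)).2 (by
          rw [show h = 2 by omega]; exact dvd_mul_right 2 k)] at hi
        exact hi.symm
    have hσb : σ b = a := by rw [hba]; simpa [sq] using hsq
    rw [hσb, ← hba] at hσab
    exact lt_asymm hab hσab
  · have hnot : ∀ x t, 0 < t → t < h → (σ ^ t) x ≠ x := fun x t h0 hlt he =>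
      absurd (Nat.le_of_dvd h0 ((hperiod x t).1 he)) (by omega)
    have halt := pow_apply_alternating hD hσab
      (fun t h0 hlt => hmem _ (hnot a t h0 hlt) fun he => hsc ⟨t, by simpa using he⟩)
      (fun t h0 hlt => hmem _ (fun he => hsc (Perm.SameCycle.symm ⟨t, by simpa using he⟩))
        (hnot b t h0 hlt)) (h - 1) (by omega)
    rw [if_neg (by rw [Nat.even_iff]; omega), Nat.sub_add_cancel (by omega),
      (hperiod a h).2 dvd_rfl, (hperiod b h).2 dvd_rfl] at halt
    exact lt_asymm hab halt
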